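/- arXiv:2101.04233 — 6 statements merged into one kernel-verified Lean document; each statement's English description precedes it below -/
import Mathlib

section
/- Let X ⊆ ℝ^{d₁} and Y ⊆ ℝ^{d₂} be nonempty compact convex sets, let ℓ > 0, and let f be a real-valued function defined and differentiable on an open convex neighborhood of X × Y whose gradient ∇f is ℓ-Lipschitz (with respect to the Euclidean norm on ℝ^{d₁} × ℝ^{d₂}). Then the max-function Φ(x) := sup_{y ∈ Y} f(x, y) is ℓ-weakly convex on X, i.e. the function x ↦ Φ(x) + (ℓ/2)‖x‖² is convex on X. -/
/-- A function on a convex set whose derivative is a monotone operator is convex. -/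
theorem convexOn_of_hasFDerivAt_of_monotone {E : Type*} [NormedAddCommGroup E] [NormedSpace ℝ E]
    {s : Set E} (hs : Convex ℝ s) {φ : E → ℝ} {φ' : E → E →L[ℝ] ℝ}
    (hφ : ∀ x ∈ s, HasFDerivAt φ (φ' x) x)
    (hmono : ∀ x ∈ s, ∀ y ∈ s, 0 ≤ (φ' x - φ' y) (x - y)) : ConvexOn ℝ s φ := by
  refine ⟨hs, fun u hu v hv a b ha hb hab => ?_⟩
  have hmem : ∀ t ∈ Set.Icc (0 : ℝ) 1, u + t • (v - u) ∈ s := fun t ht =>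
    hs.add_smul_sub_mem hu hv ht
  have hderiv : ∀ t ∈ Set.Icc (0 : ℝ) 1,
      HasDerivAt (fun t : ℝ => φ (u + t • (v - u))) (φ' (u + t • (v - u)) (v - u)) t := by
    intro t ht
    have hline : HasDerivAt (fun t : ℝ => u + t • (v - u)) (v - u) t := by
      simpa using ((hasDerivAt_id t).smul_const (v - u)).const_add u
    exact (hφ _ (hmem t ht)).comp_hasDerivAt t hline
  have hconv : ConvexOn ℝ (Set.Icc (0 : ℝ) 1) (fun t : ℝ => φ (u + t • (v - u))) := by
    refine MonotoneOn.convexOn_of_deriv (convex_Icc 0 1)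
      (fun t ht => (hderiv t ht).continuousAt.continuousWithinAt)
      (fun t ht => (hderiv t (interior_subset ht)).differentiableAt.differentiableWithinAt) ?_
    intro t ht r hr htr
    have ht' := interior_subset ht
    have hr' := interior_subset hr
    rw [(hderiv t ht').deriv, (hderiv r hr').deriv]
    rcases htr.eq_or_lt with rfl | hlt
    · exact le_rfl
    have h := hmono _ (hmem r hr') _ (hmem t ht')
    rw [add_sub_add_left_eq_sub, ← sub_smul, map_smul, smul_eq_mul,
      sub_apply] at h
    exact sub_nonneg.mp (nonneg_of_mul_nonneg_right h (sub_pos.mpr hlt))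
  have h := hconv.2 (Set.left_mem_Icc.mpr zero_le_one) (Set.right_mem_Icc.mpr zero_le_one) ha hb hab
  have hpt : u + b • (v - u) = a • u + b • v := by
    rw [eq_sub_of_add_eq hab]
    module
  simpa [hpt] using h

/-- A function with `ℓ`-Lipschitz gradient on a convex set is `ℓ`-weakly convex there. -/
theorem convexOn_add_sq_norm_of_lipschitz_gradient {E : Type*} [NormedAddCommGroup E]
    [InnerProductSpace ℝ E] {s : Set E} (hs : Convex ℝ s) {φ : E → ℝ} {g : E → E} {ℓ : ℝ}
    (hφ : ∀ x ∈ s, HasFDerivAt φ (innerSL ℝ (g x)) x)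
    (hg : ∀ x ∈ s, ∀ y ∈ s, ‖g x - g y‖ ≤ ℓ * ‖x - y‖) :
    ConvexOn ℝ s (fun x => φ x + ℓ / 2 * ‖x‖ ^ 2) := by
  refine convexOn_of_hasFDerivAt_of_monotone hs
    (fun x hx => (hφ x hx).add ((hasStrictFDerivAt_norm_sq x).hasFDerivAt.const_mul (ℓ / 2))) ?_
  intro x hx y hy
  have hcs := abs_le.mp (abs_real_inner_le_norm (g x - g y) (x - y))
  have hle := mul_le_mul_of_nonneg_right (hg x hx y hy) (norm_nonneg (x - y))
  have hsq := real_inner_self_eq_norm_sq (x - y)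
  simp only [sub_apply, add_apply,
    smul_apply, innerSL_apply_apply, smul_eq_mul, nsmul_eq_mul]
  rw [inner_sub_left] at hcs hsq
  push_cast
  linear_combination hcs.1 + hle - ℓ * hsq

/-- A pointwise supremum of convex functions, bounded above at each point, is convex. -/
theorem convexOn_sSup_image {E ι : Type*} [AddCommGroup E] [Module ℝ E] {s : Set E}
    {Y : Set ι} (hs : Convex ℝ s) (hY : Y.Nonempty) {F : E → ι → ℝ}
    (hF : ∀ y ∈ Y, ConvexOn ℝ s (fun x => F x y)) (hbdd : ∀ x ∈ s, BddAbove (F x '' Y)) :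
    ConvexOn ℝ s (fun x => sSup (F x '' Y)) := by
  refine ⟨hs, fun u hu v hv a b ha hb hab => csSup_le (hY.image _) ?_⟩
  rintro _ ⟨y, hy, rfl⟩
  refine ((hF y hy).2 hu hv ha hb hab).trans ?_
  have h₁ := le_csSup (hbdd u hu) (Set.mem_image_of_mem (F u) hy)
  have h₂ := le_csSup (hbdd v hv) (Set.mem_image_of_mem (F v) hy)
  simp only [smul_eq_mul]
  gcongr


/-- If `f` is differentiable on an open convex neighborhood `U` of `X × Y`
with `ℓ`-Lipschitz gradient (w.r.t. the Euclidean norm on the product, the gradient being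
recorded by its two components `gx`, `gy`), and `X`, `Y` are nonempty compact convex sets,
then the max-function `Φ(x) = sup_{y ∈ Y} f(x,y)` is `ℓ`-weakly convex on `X`, i.e.
`x ↦ Φ(x) + (ℓ/2)‖x‖²` is convex on `X`. -/
theorem max_function_weakly_convex {d₁ d₂ : ℕ}
    (X : Set (EuclideanSpace ℝ (Fin d₁))) (Y : Set (EuclideanSpace ℝ (Fin d₂)))
    (hXne : X.Nonempty) (hXc : IsCompact X) (hXconv : Convex ℝ X)
    (hYne : Y.Nonempty) (hYc : IsCompact Y) (hYconv : Convex ℝ Y)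
    (ℓ : ℝ) (hℓ : 0 < ℓ)
    (U : Set (EuclideanSpace ℝ (Fin d₁) × EuclideanSpace ℝ (Fin d₂)))
    (hUopen : IsOpen U) (hUconv : Convex ℝ U) (hXYU : X ×ˢ Y ⊆ U)
    (f : EuclideanSpace ℝ (Fin d₁) × EuclideanSpace ℝ (Fin d₂) → ℝ)
    (gx : EuclideanSpace ℝ (Fin d₁) × EuclideanSpace ℝ (Fin d₂) → EuclideanSpace ℝ (Fin d₁))
    (gy : EuclideanSpace ℝ (Fin d₁) × EuclideanSpace ℝ (Fin d₂) → EuclideanSpace ℝ (Fin d₂))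
    (hdiff : ∀ p ∈ U, HasFDerivAt f
      (((innerSL ℝ (gx p)).comp
          (ContinuousLinearMap.fst ℝ (EuclideanSpace ℝ (Fin d₁)) (EuclideanSpace ℝ (Fin d₂)))) +
       ((innerSL ℝ (gy p)).comp
          (ContinuousLinearMap.snd ℝ (EuclideanSpace ℝ (Fin d₁)) (EuclideanSpace ℝ (Fin d₂))))) p)
    (hgradLip : ∀ p ∈ U, ∀ q ∈ U,
      Real.sqrt (‖gx p - gx q‖ ^ 2 + ‖gy p - gy q‖ ^ 2) ≤
        ℓ * Real.sqrt (‖p.1 - q.1‖ ^ 2 + ‖p.2 - q.2‖ ^ 2))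
    (Φ : EuclideanSpace ℝ (Fin d₁) → ℝ)
    (hΦ : ∀ x, Φ x = sSup ((fun y => f (x, y)) '' Y)) :
    ConvexOn ℝ X (fun x => Φ x + (ℓ / 2) * ‖x‖ ^ 2) := by
  have hpartial : ∀ y ∈ Y, ∀ x ∈ X,
      HasFDerivAt (fun x => f (x, y)) (innerSL ℝ (gx (x, y))) x := by
    intro y hy x hx
    have h := (hdiff (x, y) (hXYU ⟨hx, hy⟩)).comp (f := fun x => (x, y)) x
      (hasFDerivAt_prodMk_left (𝕜 := ℝ) x y)
    refine h.congr_fderiv ?_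
    ext v
    simp
  have hlip : ∀ y ∈ Y, ∀ x ∈ X, ∀ x' ∈ X, ‖gx (x, y) - gx (x', y)‖ ≤ ℓ * ‖x - x'‖ := by
    intro y hy x hx x' hx'
    have h := hgradLip (x, y) (hXYU ⟨hx, hy⟩) (x', y) (hXYU ⟨hx', hy⟩)
    simp only [sub_self, norm_zero, ne_eq, OfNat.ofNat_ne_zero, not_false_eq_true, zero_pow,
      add_zero, Real.sqrt_sq (norm_nonneg _)] at h
    exact (Real.le_sqrt_of_sq_le (le_add_of_nonneg_right (sq_nonneg _))).trans h
  have hbdd : ∀ x ∈ X, BddAbove ((fun y => f (x, y)) '' Y) := by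
    intro x hx
    refine (hYc.image_of_continuousOn fun y hy => ?_).bddAbove
    have hc : ContinuousAt (fun y => f (x, y)) y :=
      (hdiff (x, y) (hXYU ⟨hx, hy⟩)).continuousAt.comp (f := fun y => (x, y)) (by fun_prop)
    exact hc.continuousWithinAt
  have hweak : ∀ y ∈ Y, ConvexOn ℝ X (fun x => f (x, y) + ℓ / 2 * ‖x‖ ^ 2) := fun y hy =>
    convexOn_add_sq_norm_of_lipschitz_gradient hXconv (hpartial y hy) (hlip y hy)
  have himage : ∀ x, (fun y => f (x, y) + ℓ / 2 * ‖x‖ ^ 2) '' Y =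
      (fun r => r + ℓ / 2 * ‖x‖ ^ 2) '' ((fun y => f (x, y)) '' Y) := fun x => by
    rw [Set.image_image]
  have hmono : ∀ c : ℝ, Monotone (fun r : ℝ => r + c) := fun c _ _ h => add_le_add_left h c
  refine (convexOn_sSup_image hXconv hYne hweak fun x hx => ?_).congr fun x hx => ?_
  · rw [himage]
    exact (hmono _).map_bddAbove (hbdd x hx)
  · simp only [himage, hΦ]
    exact ((hmono _).map_csSup_of_continuousAt (by fun_prop) (hYne.image _) (hbdd x hx)).symm
end

section
/- Let s, ε ∈ (0,1), let R = [[−1, ε], [−ε, 0]] and S = [[s, s], [1, 1]] be 2×2 real matrices, let Δ := {(u₁,u₂) ∈ ℝ² : u₁ ≥ 0, u₂ ≥ 0, u₁ + u₂ = 1}, and define V(x,y) := ⟨x, Ry⟩ / ⟨x, Sy⟩ for x, y ∈ Δ. Then: (1) for all x, y ∈ Δ one has ⟨x, Sy⟩ = s·x₁ + x₂ ≥ s > 0, so V is well defined; and (2) the pair (x*, y*) with x* = y* = (0,1) is the unique Nash equilibrium of the ratio game, i.e. V(x*, y) ≤ V(x*, y*) ≤ V(x, y*) for all x, y ∈ Δ,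 and any pair (x̂, ŷ) ∈ Δ × Δ satisfying V(x̂, y) ≤ V(x̂, ŷ) ≤ V(x, ŷ) for all x, y ∈ Δ equals (x*, y*). -/
/-- The simplex `Δ ⊆ ℝ²`. -/
def simplex2 : Set (ℝ × ℝ) := {u | 0 ≤ u.1 ∧ 0 ≤ u.2 ∧ u.1 + u.2 = 1}

/-- Euclidean inner product on `ℝ²`. -/
def dot2 (u v : ℝ × ℝ) : ℝ := u.1 * v.1 + u.2 * v.2

/-- `R y` for `R = [[−1, ε], [−ε, 0]]`. -/
def Rmul (ε : ℝ) (y : ℝ × ℝ) : ℝ × ℝ := (-y.1 + ε * y.2, -ε * y.1)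

/-- `S y` for `S = [[s, s], [1, 1]]`. -/
def Smul (s : ℝ) (y : ℝ × ℝ) : ℝ × ℝ := (s * y.1 + s * y.2, y.1 + y.2)

/-- The value of the von Neumann ratio game: `V(x,y) = ⟨x, Ry⟩ / ⟨x, Sy⟩`. -/
noncomputable def ratioV (s ε : ℝ) (x y : ℝ × ℝ) : ℝ :=
  dot2 x (Rmul ε y) / dot2 x (Smul s y)

theorem dot2_Smul_of_mem (s : ℝ) (x : ℝ × ℝ) {y : ℝ × ℝ} (hy : y ∈ simplex2) :
    dot2 x (Smul s y) = s * x.1 + x.2 := by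
  simp only [dot2, Smul]
  linear_combination (s * x.1 + x.2) * hy.2.2

theorem dot2_Rmul_of_mem (ε : ℝ) {x y : ℝ × ℝ} (hx : x ∈ simplex2) (hy : y ∈ simplex2) :
    dot2 x (Rmul ε y) = ε * x.1 - y.1 * (x.1 + ε) := by
  simp only [dot2, Rmul]
  linear_combination ε * x.1 * hy.2.2 - ε * y.1 * hx.2.2

theorem le_dot2_Smul {s : ℝ} (hs : s ≤ 1) {x y : ℝ × ℝ} (hx : x ∈ simplex2)
    (hy : y ∈ simplex2) : s ≤ dot2 x (Smul s y) := by
  rw [dot2_Smul_of_mem s x hy]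
  nlinarith [mul_nonneg (sub_nonneg.2 hs) hx.2.1, hx.2.2]

theorem ratioV_eq_of_mem (s ε : ℝ) {x y : ℝ × ℝ} (hx : x ∈ simplex2) (hy : y ∈ simplex2) :
    ratioV s ε x y = (ε * x.1 - y.1 * (x.1 + ε)) / (s * x.1 + x.2) := by
  rw [ratioV, dot2_Smul_of_mem s x hy, dot2_Rmul_of_mem ε hx hy]

/-- For the ratio game with `R = [[−1,ε],[−ε,0]]`, `S = [[s,s],[1,1]]`,
`s, ε ∈ (0,1)`: (1) `⟨x, Sy⟩ = s·x₁ + x₂ ≥ s > 0` on the simplex, and (2) `x* = y* = (0,1)`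
is the unique Nash equilibrium. -/
theorem ratio_game_unique_nash (s ε : ℝ) (hs : s ∈ Set.Ioo (0 : ℝ) 1)
    (hε : ε ∈ Set.Ioo (0 : ℝ) 1) :
    (∀ x ∈ simplex2, ∀ y ∈ simplex2,
      dot2 x (Smul s y) = s * x.1 + x.2 ∧ s ≤ dot2 x (Smul s y) ∧ 0 < dot2 x (Smul s y)) ∧
    ((0, 1) : ℝ × ℝ) ∈ simplex2 ∧
    (∀ y ∈ simplex2, ratioV s ε (0, 1) y ≤ ratioV s ε (0, 1) (0, 1)) ∧
    (∀ x ∈ simplex2, ratioV s ε (0, 1) (0, 1) ≤ ratioV s ε x (0, 1)) ∧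
    (∀ xhat ∈ simplex2, ∀ yhat ∈ simplex2,
      (∀ y ∈ simplex2, ratioV s ε xhat y ≤ ratioV s ε xhat yhat) →
      (∀ x ∈ simplex2, ratioV s ε xhat yhat ≤ ratioV s ε x yhat) →
      xhat = ((0, 1) : ℝ × ℝ) ∧ yhat = ((0, 1) : ℝ × ℝ)) := by
  obtain ⟨hs0, hs1⟩ := hs
  obtain ⟨hε0, -⟩ := hε
  have h01 : ((0, 1) : ℝ × ℝ) ∈ simplex2 := by simp [simplex2]
  have hpos : ∀ x ∈ simplex2, 0 < s * x.1 + x.2 := fun x hx => by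
    rw [← dot2_Smul_of_mem s x h01]
    exact hs0.trans_le (le_dot2_Smul hs1.le hx h01)
  have hfst : ∀ u ∈ simplex2, u.1 ≤ 0 → u = (0, 1) := fun u hu hle =>
    have h0 : u.1 = 0 := le_antisymm hle hu.1
    Prod.ext h0 (by linarith [hu.2.2] : u.2 = 1)
  refine ⟨fun x hx y hy => ⟨dot2_Smul_of_mem s x hy, le_dot2_Smul hs1.le hx hy,
    hs0.trans_le (le_dot2_Smul hs1.le hx hy)⟩, h01, fun y hy => ?_, fun x hx => ?_,
    fun x hx y hy hmax hmin => ?_⟩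
  · rw [ratioV_eq_of_mem s ε h01 hy, ratioV_eq_of_mem s ε h01 h01]
    simpa using mul_nonneg hy.1 hε0.le
  · rw [ratioV_eq_of_mem s ε h01 h01, ratioV_eq_of_mem s ε hx h01]
    simpa using div_nonneg (mul_nonneg hε0.le hx.1) (hpos x hx).le
  · have hy' : y = (0, 1) := by
      have h := hmax _ h01
      rw [ratioV_eq_of_mem s ε hx h01, ratioV_eq_of_mem s ε hx hy,
        div_le_div_iff_of_pos_right (hpos x hx)] at h
      have hx0 := hx.1
      exact hfst y hy (nonpos_of_mul_nonpos_left (by linarith) (by linarith : 0 < x.1 + ε))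
    subst hy'
    refine ⟨hfst x hx ?_, rfl⟩
    have h := hmin _ h01
    rw [ratioV_eq_of_mem s ε hx h01, ratioV_eq_of_mem s ε h01 h01,
      div_le_iff₀ (hpos x hx)] at h
    exact nonpos_of_mul_nonpos_right (by simpa using h) hε0
end

section
/- Let s, ε ∈ (0,1) with ε < (1−s)/(2s), let R = [[−1, ε], [−ε, 0]] and S = [[s, s], [1, 1]], let Δ := {(u₁,u₂) ∈ ℝ² : u₁ ≥ 0, u₂ ≥ 0, u₁ + u₂ = 1}, and define F(x,y) := ( (⟨x,Sy⟩·Ry − ⟨x,Ry⟩·Sy)/⟨x,Sy⟩², −(⟨x,Sy⟩·Rᵀx − ⟨x,Ry⟩·Sᵀx)/⟨x,Sy⟩² ) for (x,y) ∈ Δ × Δ. Then for every ẑ ∈ Δ × Δ there exists z ∈ Δ × Δ such that ⟨F(z), z − ẑ⟩ < 0; that is, the Minty variational inequality property ⟨F(z), z − ẑ⟩ ≥ 0 for all z ∈ Δ × Δ fails for every choice of reference point ẑ. -/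
/-- Euclidean inner product on `ℝ² × ℝ²`. -/
def dot4 (u v : (ℝ × ℝ) × (ℝ × ℝ)) : ℝ := dot2 u.1 v.1 + dot2 u.2 v.2

/-- `Rᵀ x` for `R = [[−1, ε], [−ε, 0]]`. -/
def RTmul (ε : ℝ) (x : ℝ × ℝ) : ℝ × ℝ := (-x.1 - ε * x.2, ε * x.1)

/-- `Sᵀ x` for `S = [[s, s], [1, 1]]`. -/
def STmul (s : ℝ) (x : ℝ × ℝ) : ℝ × ℝ := (s * x.1 + x.2, s * x.1 + x.2)

/-- The vector field `F(x,y) = (∇ₓV(x,y), −∇_yV(x,y))` of the ratio game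
`V(x,y) = ⟨x,Ry⟩/⟨x,Sy⟩`. -/
noncomputable def ratioF (s ε : ℝ) (z : (ℝ × ℝ) × (ℝ × ℝ)) : (ℝ × ℝ) × (ℝ × ℝ) :=
  ((dot2 z.1 (Smul s z.2))⁻¹ ^ 2 •
      (dot2 z.1 (Smul s z.2) • Rmul ε z.2 - dot2 z.1 (Rmul ε z.2) • Smul s z.2),
   -((dot2 z.1 (Smul s z.2))⁻¹ ^ 2 •
      (dot2 z.1 (Smul s z.2) • RTmul ε z.1 - dot2 z.1 (Rmul ε z.2) • STmul s z.1)))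

/-- In the coordinates `x = (p, 1 - p)`, `y = (q, 1 - q)` the Minty form of the ratio game is a
polynomial divided by the square of `⟨x, S y⟩ = s p + 1 - p`. -/
theorem dot4_ratioF_sub (s ε p q a b : ℝ) (hD : s * p + (1 - p) ≠ 0) :
    dot4 (ratioF s ε ((p, 1 - p), (q, 1 - q)))
        (((p, 1 - p), (q, 1 - q)) - ((a, 1 - a), (b, 1 - b))) =
      ((ε - q * (1 + (1 - s) * ε)) * (p - a) + (p + ε) * (s * p + (1 - p)) * (q - b)) /
        (s * p + (1 - p)) ^ 2 := by
  have hS : dot2 (p, 1 - p) (Smul s (q, 1 - q)) = s * p + (1 - p) := by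
    simp only [dot2, Smul]
    ring
  simp only [dot4, ratioF, hS]
  simp only [dot2, Smul, Rmul, RTmul, STmul, Prod.fst_sub, Prod.snd_sub, Prod.smul_fst,
    Prod.smul_snd, Prod.fst_neg, Prod.snd_neg, smul_eq_mul]
  field_simp
  ring

theorem mk_one_sub_mem_simplex2 {p : ℝ} (h0 : 0 ≤ p) (h1 : p ≤ 1) :
    (p, 1 - p) ∈ simplex2 :=
  ⟨h0, sub_nonneg.2 h1, add_sub_cancel p 1⟩

theorem mul_add_one_sub_pos {s p : ℝ} (hs : 0 < s) (h0 : 0 ≤ p) (h1 : p ≤ 1) :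
    0 < s * p + (1 - p) := by
  rcases h0.eq_or_lt with rfl | hp
  · norm_num
  · exact add_pos_of_pos_of_nonneg (mul_pos hs hp) (sub_nonneg.2 h1)

/-- For `s, ε ∈ (0,1)` with `ε < (1−s)/(2s)`, the Minty variational
inequality property fails for *every* reference point `ẑ ∈ Δ × Δ`: there is always some
`z ∈ Δ × Δ` with `⟨F(z), z − ẑ⟩ < 0`. -/
theorem ratio_game_mvi_fails_everywhere (s ε : ℝ) (hs : s ∈ Set.Ioo (0 : ℝ) 1)
    (hε : ε ∈ Set.Ioo (0 : ℝ) 1) (hεs : ε < (1 - s) / (2 * s)) :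
    ∀ zhat ∈ simplex2 ×ˢ simplex2, ∃ z ∈ simplex2 ×ˢ simplex2,
      dot4 (ratioF s ε z) (z - zhat) < 0 := by
  obtain ⟨hs0, -⟩ := hs
  obtain ⟨hε0, -⟩ := hε
  rintro ⟨⟨a, a'⟩, ⟨b, b'⟩⟩ ⟨⟨ha, ha', haa⟩, ⟨hb, hb', hbb⟩⟩
  dsimp only at ha ha' haa hb hb' hbb
  obtain rfl : a' = 1 - a := by linarith
  obtain rfl : b' = 1 - b := by linarith
  suffices h : ∃ p q : ℝ, 0 ≤ p ∧ p ≤ 1 ∧ 0 ≤ q ∧ q ≤ 1 ∧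
      (ε - q * (1 + (1 - s) * ε)) * (p - a) + (p + ε) * (s * p + (1 - p)) * (q - b) < 0 by
    obtain ⟨p, q, hp0, hp1, hq0, hq1, h⟩ := h
    have hD := mul_add_one_sub_pos hs0 hp0 hp1
    refine ⟨((p, 1 - p), (q, 1 - q)),
      ⟨mk_one_sub_mem_simplex2 hp0 hp1, mk_one_sub_mem_simplex2 hq0 hq1⟩, ?_⟩
    rw [dot4_ratioF_sub s ε p q a b hD.ne']
    exact div_neg_of_neg_of_pos h (by positivity)
  rcases hb.eq_or_lt with rfl | hb
  · rcases ha.eq_or_lt with rfl | ha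
    · rw [lt_div_iff₀ (by positivity)] at hεs
      exact ⟨1, 1, by norm_num, le_rfl, by norm_num, le_rfl, by linarith⟩
    · have := mul_pos hε0 ha
      exact ⟨0, 0, le_rfl, by norm_num, le_rfl, by norm_num, by linarith⟩
  · refine ⟨a, 0, ha, by linarith, le_rfl, by norm_num, ?_⟩
    have hD := mul_add_one_sub_pos hs0 ha (by linarith)
    have : 0 < (a + ε) * (s * a + (1 - a)) * b := by positivity
    linarith
end

section
/- Let s, ε ∈ (0,1), let R = [[−1, ε], [−ε, 0]] and S = [[s, s], [1, 1]], let Δ := {(u₁,u₂) ∈ ℝ² : u₁ ≥ 0, u₂ ≥ 0, u₁ + u₂ = 1}, define V(x,y) := ⟨x, Ry⟩/⟨x, Sy⟩ and F(x,y) := ( (⟨x,Sy⟩·Ry − ⟨x,Ry⟩·Sy)/⟨x,Sy⟩², −(⟨x,Sy⟩·Rᵀx − ⟨x,Ry⟩·Sᵀx)/⟨x,Sy⟩² ) for (x,y) ∈ Δ × Δ. Suppose ẑ = (x̂, ŷ) ∈ Δ × Δ is such that there exists x ∈ Δ with V(x, ŷ) < V(x̂, ŷ) (i.e. the min-player can strictly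 improve against ŷ). Then there exists α ∈ (0,1) such that the point z := ((1−α)·x̂ + α·x, ŷ) ∈ Δ × Δ satisfies ⟨F(z), z − ẑ⟩ < 0. -/
lemma simplex2_convex : Convex ℝ simplex2 := by
  rintro u ⟨hu₁, hu₂, hu⟩ v ⟨hv₁, hv₂, hv⟩ a b ha hb hab
  refine ⟨?_, ?_, ?_⟩ <;> simp only [Prod.fst_add, Prod.snd_add, Prod.smul_fst, Prod.smul_snd,
    smul_eq_mul]
  · positivity
  · positivity
  · linear_combination a * hu + b * hv + hab

lemma dot2_Smul_pos {s : ℝ} (hs : 0 < s) {x y : ℝ × ℝ} (hx : x ∈ simplex2)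
    (hy : y ∈ simplex2) : 0 < dot2 x (Smul s y) := by
  obtain ⟨hx₁, hx₂, hx⟩ := hx
  have h : dot2 x (Smul s y) = s * x.1 + x.2 := by
    simp only [dot2, Smul]
    linear_combination (s * x.1 + x.2) * hy.2.2
  rw [h]
  rcases hx₁.eq_or_lt with h₁ | h₁
  · rw [← h₁] at hx ⊢
    linarith
  · positivity

/-- The numerator of the derivative of `u ↦ ⟨u, r⟩ / ⟨u, w⟩` along a segment is constant. -/
lemma dot2_quotient_gradient_segment (k α : ℝ) (u v r w : ℝ × ℝ) :
    dot2 (k • (dot2 ((1 - α) • u + α • v) w • r - dot2 ((1 - α) • u + α • v) r • w))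
      ((1 - α) • u + α • v - u) = k * α * (dot2 v r * dot2 u w - dot2 u r * dot2 v w) := by
  simp only [dot2, Prod.fst_add, Prod.snd_add, Prod.fst_sub, Prod.snd_sub, Prod.smul_fst,
    Prod.smul_snd, smul_eq_mul]
  ring

/-- If the min-player can strictly improve against `ŷ`, i.e. `V(x,ŷ) <
V(x̂,ŷ)` for some `x ∈ Δ`, then moving a little from `x̂` towards `x` produces a point
`z = ((1−α)x̂ + αx, ŷ) ∈ Δ × Δ` violating the Minty inequality at `ẑ = (x̂, ŷ)`. -/
theorem ratio_game_improvement_violates_mvi (s ε : ℝ) (hs : s ∈ Set.Ioo (0 : ℝ) 1)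
    (hε : ε ∈ Set.Ioo (0 : ℝ) 1)
    (xhat yhat x : ℝ × ℝ) (hxhat : xhat ∈ simplex2) (hyhat : yhat ∈ simplex2)
    (hx : x ∈ simplex2) (himp : ratioV s ε x yhat < ratioV s ε xhat yhat) :
    ∃ α ∈ Set.Ioo (0 : ℝ) 1,
      ((1 - α) • xhat + α • x, yhat) ∈ simplex2 ×ˢ simplex2 ∧
      dot4 (ratioF s ε ((1 - α) • xhat + α • x, yhat))
          ((((1 - α) • xhat + α • x, yhat) : (ℝ × ℝ) × (ℝ × ℝ)) - (xhat, yhat)) < 0 := by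
  have hmem : (1 - 1 / 2 : ℝ) • xhat + (1 / 2 : ℝ) • x ∈ simplex2 :=
    simplex2_convex hxhat hx (by norm_num) (by norm_num) (by norm_num)
  refine ⟨1 / 2, by norm_num, ⟨hmem, hyhat⟩, ?_⟩
  have hD := dot2_Smul_pos hs.1 hmem hyhat
  have hN := (div_lt_div_iff₀ (dot2_Smul_pos hs.1 hx hyhat)
    (dot2_Smul_pos hs.1 hxhat hyhat)).1 himp
  simp only [dot4, ratioF, Prod.fst_sub, Prod.snd_sub]
  rw [dot2_quotient_gradient_segment, sub_self]
  simp only [dot2, Prod.fst_zero, Prod.snd_zero, mul_zero, add_zero] at hN hD ⊢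
  exact mul_neg_of_pos_of_neg (by positivity) (sub_neg.2 hN)
end

section
/- Let s, ε ∈ (0,1), let R = [[−1, ε], [−ε, 0]] and S = [[s, s], [1, 1]], let Δ := {(u₁,u₂) ∈ ℝ² : u₁ ≥ 0, u₂ ≥ 0, u₁ + u₂ = 1}, and define V(x,y) := ⟨x, Ry⟩/⟨x, Sy⟩ for x, y ∈ Δ. Then: (1) for every x = (x₁, x₂) ∈ Δ, max_{y ∈ Δ} V(x, y) = ε·x₁/(s·x₁ + x₂), which is strictly positive whenever x₁ > 0; and (2) for every y = (y₁, y₂) ∈ Δ, min_{x ∈ Δ} V(x, y) = min{ (ε·y₂ − y₁)/s , −ε·y₁ }, which is strictly negative whenever y₁ > 0. -/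
/-- On the simplex the denominator of the ratio game depends only on `x`. -/
theorem ratioV_eq {s ε : ℝ} {x y : ℝ × ℝ} (hy : y ∈ simplex2) :
    ratioV s ε x y =
      (x.1 * (ε * y.2 - y.1) + x.2 * (-(ε * y.1))) / (s * x.1 + x.2) := by
  have h : y.1 + y.2 = 1 := hy.2.2
  simp only [ratioV, dot2, Rmul, Smul, ← mul_add, h]
  congr 1 <;> ring

theorem denom_pos {s : ℝ} (hs : 0 < s) {x : ℝ × ℝ} (hx : x ∈ simplex2) :
    0 < s * x.1 + x.2 := by
  obtain ⟨h1, h2, h3⟩ := hx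
  rcases h1.eq_or_lt with h | h
  · rw [← h] at h3 ⊢
    linarith
  · positivity

/-- For the ratio game with `R = [[−1,ε],[−ε,0]]`, `S = [[s,s],[1,1]]`:
(1) `max_{y∈Δ} V(x,y) = ε·x₁/(s·x₁ + x₂)`, strictly positive when `x₁ > 0`; and
(2) `min_{x∈Δ} V(x,y) = min{(ε·y₂ − y₁)/s, −ε·y₁}`, strictly negative when `y₁ > 0`. -/
theorem ratio_game_best_responses (s ε : ℝ) (hs : s ∈ Set.Ioo (0 : ℝ) 1)
    (hε : ε ∈ Set.Ioo (0 : ℝ) 1) :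
    (∀ x ∈ simplex2,
      IsGreatest ((fun y => ratioV s ε x y) '' simplex2) (ε * x.1 / (s * x.1 + x.2)) ∧
      (0 < x.1 → 0 < ε * x.1 / (s * x.1 + x.2))) ∧
    (∀ y ∈ simplex2,
      IsLeast ((fun x => ratioV s ε x y) '' simplex2) (min ((ε * y.2 - y.1) / s) (-(ε * y.1))) ∧
      (0 < y.1 → min ((ε * y.2 - y.1) / s) (-(ε * y.1)) < 0)) := by
  obtain ⟨hs, -⟩ := hs
  obtain ⟨hε, -⟩ := hε
  have e₁ : ((1, 0) : ℝ × ℝ) ∈ simplex2 := by simp [simplex2]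
  have e₂ : ((0, 1) : ℝ × ℝ) ∈ simplex2 := by simp [simplex2]
  refine ⟨fun x hx => ?_, fun y hy => ?_⟩
  · have hd := denom_pos hs hx
    refine ⟨⟨⟨(0, 1), e₂, ?_⟩, ?_⟩, fun h => by positivity⟩
    · simp [ratioV_eq e₂, mul_comm]
    · rintro _ ⟨y, hy, rfl⟩
      simp only [ratioV_eq hy]
      obtain ⟨hx1, hx2, -⟩ := hx
      obtain ⟨hy1, -, hy⟩ := hy
      gcongr
      have hy2 : y.2 = 1 - y.1 := by linarith
      rw [hy2]
      linarith [mul_nonneg hx1 hy1, mul_nonneg hε.le (mul_nonneg hx1 hy1),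
        mul_nonneg hε.le (mul_nonneg hx2 hy1)]
  · refine ⟨⟨?_, ?_⟩, fun h => min_lt_of_right_lt (neg_neg_of_pos (mul_pos hε h))⟩
    · rcases min_choice ((ε * y.2 - y.1) / s) (-(ε * y.1)) with h | h <;> rw [h]
      · exact ⟨(1, 0), e₁, by simp [ratioV_eq hy]⟩
      · exact ⟨(0, 1), e₂, by simp [ratioV_eq hy]⟩
    · rintro _ ⟨x, hx, rfl⟩
      simp only [ratioV_eq hy]
      rw [le_div_iff₀ (denom_pos hs hx)]
      have ha := (le_div_iff₀ hs).1 (min_le_left ((ε * y.2 - y.1) / s) (-(ε * y.1)))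
      have hb := min_le_right ((ε * y.2 - y.1) / s) (-(ε * y.1))
      linarith [mul_le_mul_of_nonneg_left ha hx.1, mul_le_mul_of_nonneg_left hb hx.2.1]
end

section
/- Let X ⊆ ℝ^{d₁} and Y ⊆ ℝ^{d₂} be nonempty compact convex sets, let ℓ > 0, and let f be a real-valued function defined and differentiable on an open neighborhood of X × Y whose gradient is ℓ-Lipschitz (with respect to the Euclidean norm on the product). Define Φ(x) := max_{y ∈ Y} f(x, y). Fix x ∈ X and y ∈ Y, and let x̂ be the unique minimizer of x' ↦ Φ(x') + ℓ‖x' − x‖² over X. Then ⟨x̂ − x, ∇_x f(x, y)⟩ ≤ ( Φ(x) − f(x, y) ) − (ℓ/2)‖x̂ − x‖². -/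
open scoped RealInnerProductSpace

/-- A quadratic lower bound for a function whose gradient varies in a Lipschitz manner
around the base point of a convex set. -/
theorem Convex.add_inner_sub_le_of_gradient_lipschitz {E : Type*} [NormedAddCommGroup E]
    [InnerProductSpace ℝ E] {s : Set E} (hs : Convex ℝ s) {f : E → ℝ} {g : E → E} {ℓ : ℝ}
    {a b : E} (ha : a ∈ s) (hb : b ∈ s)
    (hf : ∀ z ∈ s, HasFDerivAt f (innerSL ℝ (g z)) z)
    (hg : ∀ z ∈ s, ‖g z - g a‖ ≤ ℓ * ‖z - a‖) :
    f a + ⟪b - a, g a⟫ - ℓ / 2 * ‖b - a‖ ^ 2 ≤ f b := by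
  have hmem : ∀ t ∈ Set.Icc (0 : ℝ) 1, a + t • (b - a) ∈ s := fun t ht =>
    hs.add_smul_sub_mem ha hb ht
  let h : ℝ → ℝ := fun t =>
    f (a + t • (b - a)) - t * ⟪b - a, g a⟫ + ℓ / 2 * ‖b - a‖ ^ 2 * t ^ 2
  have hderiv : ∀ t ∈ Set.Icc (0 : ℝ) 1, HasDerivAt h
      (⟪g (a + t • (b - a)), b - a⟫ - ⟪b - a, g a⟫ + ℓ * ‖b - a‖ ^ 2 * t) t := by
    intro t ht
    have hline : HasDerivAt (fun t : ℝ => a + t • (b - a)) (b - a) t := by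
      simpa using ((hasDerivAt_id t).smul_const (b - a)).const_add a
    have h1 := (hf _ (hmem t ht)).comp_hasDerivAt t hline
    have h2 := (hasDerivAt_id t).mul_const ⟪b - a, g a⟫
    have h3 := (hasDerivAt_pow 2 t).const_mul (ℓ / 2 * ‖b - a‖ ^ 2)
    refine ((h1.sub h2).add h3).congr_deriv ?_
    simp only [innerSL_apply_apply]
    push_cast
    ring
  have hmono : MonotoneOn h (Set.Icc 0 1) := by
    refine monotoneOn_of_hasDerivWithinAt_nonneg (convex_Icc 0 1)
      (fun t ht => (hderiv t ht).continuousAt.continuousWithinAt)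
      (fun t ht => (hderiv t (interior_subset ht)).hasDerivWithinAt) ?_
    intro t ht
    have ht' := interior_subset ht
    have hlip := hg _ (hmem t ht')
    rw [add_sub_cancel_left, norm_smul, Real.norm_of_nonneg ht'.1] at hlip
    have hcs := (abs_le.1 (abs_real_inner_le_norm (g (a + t • (b - a)) - g a) (b - a))).1
    rw [inner_sub_left, real_inner_comm (b - a) (g a)] at hcs
    have := mul_le_mul_of_nonneg_right hlip (norm_nonneg (b - a))
    linarith
  have key := hmono (Set.left_mem_Icc.2 zero_le_one) (Set.right_mem_Icc.2 zero_le_one) zero_le_one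
  simp only [h, zero_smul, add_zero, one_smul, add_sub_cancel] at key
  linarith

/-- For `f` with `ℓ`-Lipschitz gradient (components `gx`, `gy`, w.r.t. the
Euclidean norm on the product) on a neighborhood of `X × Y`, letting
`Φ(x) = max_{y∈Y} f(x,y)` and `x̂` the minimizer of `x' ↦ Φ(x') + ℓ‖x' − x‖²` over `X`, one
has `⟨x̂ − x, ∇ₓf(x,y)⟩ ≤ (Φ(x) − f(x,y)) − (ℓ/2)‖x̂ − x‖²`. -/
theorem prox_point_descent_inequality {d₁ d₂ : ℕ}
    (X : Set (EuclideanSpace ℝ (Fin d₁))) (Y : Set (EuclideanSpace ℝ (Fin d₂)))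
    (hXne : X.Nonempty) (hXc : IsCompact X) (hXconv : Convex ℝ X)
    (hYne : Y.Nonempty) (hYc : IsCompact Y) (hYconv : Convex ℝ Y)
    (ℓ : ℝ) (hℓ : 0 < ℓ)
    (U : Set (EuclideanSpace ℝ (Fin d₁) × EuclideanSpace ℝ (Fin d₂)))
    (hUopen : IsOpen U) (hXYU : X ×ˢ Y ⊆ U)
    (f : EuclideanSpace ℝ (Fin d₁) × EuclideanSpace ℝ (Fin d₂) → ℝ)
    (gx : EuclideanSpace ℝ (Fin d₁) × EuclideanSpace ℝ (Fin d₂) → EuclideanSpace ℝ (Fin d₁))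
    (gy : EuclideanSpace ℝ (Fin d₁) × EuclideanSpace ℝ (Fin d₂) → EuclideanSpace ℝ (Fin d₂))
    (hdiff : ∀ p ∈ U, HasFDerivAt f
      (((innerSL ℝ (gx p)).comp
          (ContinuousLinearMap.fst ℝ (EuclideanSpace ℝ (Fin d₁)) (EuclideanSpace ℝ (Fin d₂)))) +
       ((innerSL ℝ (gy p)).comp
          (ContinuousLinearMap.snd ℝ (EuclideanSpace ℝ (Fin d₁)) (EuclideanSpace ℝ (Fin d₂))))) p)
    (hgradLip : ∀ p ∈ U, ∀ q ∈ U,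
      Real.sqrt (‖gx p - gx q‖ ^ 2 + ‖gy p - gy q‖ ^ 2) ≤
        ℓ * Real.sqrt (‖p.1 - q.1‖ ^ 2 + ‖p.2 - q.2‖ ^ 2))
    (Φ : EuclideanSpace ℝ (Fin d₁) → ℝ)
    (hΦ : ∀ x, Φ x = sSup ((fun y => f (x, y)) '' Y)) :
    ∀ x ∈ X, ∀ y ∈ Y, ∀ xhat ∈ X,
      (∀ u ∈ X, Φ xhat + ℓ * ‖xhat - x‖ ^ 2 ≤ Φ u + ℓ * ‖u - x‖ ^ 2) →
      ⟪xhat - x, gx (x, y)⟫ ≤ (Φ x - f (x, y)) - (ℓ / 2) * ‖xhat - x‖ ^ 2 := by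
  intro x hx y hy xhat hxhat hmin
  have hU : ∀ z ∈ X, (z, y) ∈ U := fun z hz => hXYU ⟨hz, hy⟩
  have hdescent : f (x, y) + ⟪xhat - x, gx (x, y)⟫ - ℓ / 2 * ‖xhat - x‖ ^ 2 ≤ f (xhat, y) := by
    refine hXconv.add_inner_sub_le_of_gradient_lipschitz (f := fun z => f (z, y))
      (g := fun z => gx (z, y)) hx hxhat (fun z hz => ?_) (fun z hz => ?_)
    · refine ((hdiff _ (hU z hz)).comp z (hasFDerivAt_prodMk_left z y)).congr_fderiv ?_
      ext v
      simp
    · have hlip := hgradLip _ (hU z hz) _ (hU x hx)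
      simp only [sub_self, norm_zero, ne_eq, OfNat.ofNat_ne_zero, not_false_eq_true, zero_pow,
        add_zero, Real.sqrt_sq (norm_nonneg _)] at hlip
      exact (Real.le_sqrt_of_sq_le (le_add_of_nonneg_right (sq_nonneg _))).trans hlip
  have hcont : ContinuousOn (fun y => f (xhat, y)) Y := fun y' hy' =>
    ((hdiff _ (hXYU ⟨hxhat, hy'⟩)).continuousAt.comp
      (Continuous.prodMk_right xhat).continuousAt).continuousWithinAt
  have hle : f (xhat, y) ≤ Φ xhat := by
    rw [hΦ]
    exact le_csSup (hYc.image_of_continuousOn hcont).bddAbove ⟨y, hy, rfl⟩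
  have hprox := hmin x hx
  rw [sub_self, norm_zero] at hprox
  linarith
end
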